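/- arXiv:2101.10694 — 3 statements merged into one kernel-verified Lean document; each statement's English description precedes it below -/
import Mathlib

section
/- Let m, u, v, t be natural numbers with u ≤ v ≤ m and v ≤ t ≤ min(u + v, m). The number of ordered pairs (i, i′) of binary patterns of length m with weight(i) = u, weight(i′) = v, and Hamming distance d_h(i,i′) = 2t − (u + v), equals C(m,t)·C(t,v)·C(v, (u + v) − t), where C(·,·) is the binomial coefficient. -/
open Finset

/-- The weight of a binary pattern: the number of positions where it equals `true`. -/
def wt {α : Type*} [Fintype α] (i : α → Bool) : ℕ :=
  (Finset.univ.filter fun a => i a = true).card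

/-- The number of ordered pairs of subsets with cardinalities `u`, `v` whose union has
cardinality `t`. -/
theorem card_filter_card_union_eq {α : Type*} [Fintype α] [DecidableEq α] {u v t : ℕ}
    (ht : t ≤ u + v) :
    ((Finset.univ : Finset (Finset α × Finset α)).filter
        (fun p => p.1.card = u ∧ p.2.card = v ∧ (p.1 ∪ p.2).card = t)).card
      = (Fintype.card α).choose t * t.choose v * v.choose (u + v - t) := by
  have hcard : ((powersetCard t (univ : Finset α)).sigma fun T =>
      (powersetCard v T).sigma fun B => powersetCard (u + v - t) B).card
        = (Fintype.card α).choose t * t.choose v * v.choose (u + v - t) := by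
    have hinner : ∀ T ∈ powersetCard t (univ : Finset α),
        ((powersetCard v T).sigma fun B => powersetCard (u + v - t) B).card
          = t.choose v * v.choose (u + v - t) := by
      intro T hT
      rw [card_sigma, sum_const_nat (m := v.choose (u + v - t)), card_powersetCard,
        (mem_powersetCard.1 hT).2]
      intro B hB
      rw [card_powersetCard, (mem_powersetCard.1 hB).2]
    rw [card_sigma, sum_const_nat hinner, card_powersetCard, card_univ, mul_assoc]
  rw [← hcard]
  refine card_nbij' (fun p => ⟨p.1 ∪ p.2, p.2, p.1 ∩ p.2⟩)
    (fun x => ((x.1 \ x.2.1) ∪ x.2.2, x.2.1)) ?_ ?_ ?_ ?_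
  · rintro ⟨A, B⟩ h
    simp only [coe_filter, mem_univ, true_and, Set.mem_ofPred_eq] at h
    have := card_union_add_card_inter A B
    simp only [mem_coe, mem_sigma, mem_powersetCard, subset_univ, true_and,
      subset_union_right, inter_subset_right]
    omega
  · rintro ⟨T, B, S⟩ h
    simp only [mem_coe, mem_sigma, mem_powersetCard, subset_univ, true_and] at h
    obtain ⟨hT, ⟨hBT, hB⟩, hSB, hS⟩ := h
    have hdisj : Disjoint (T \ B) S := disjoint_sdiff_self_left.mono_right hSB
    have hunion : T \ B ∪ S ∪ B = T := by
      rw [union_assoc, union_eq_right.2 hSB, sdiff_union_of_subset hBT]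
    have hle := card_le_card hBT
    simp only [coe_filter, mem_univ, true_and, Set.mem_ofPred_eq, hunion,
      card_union_of_disjoint hdisj, card_sdiff_of_subset hBT]
    omega
  · rintro ⟨A, B⟩ -
    refine Prod.ext ?_ rfl
    ext a
    simp only [mem_union, mem_sdiff, mem_inter]
    tauto
  · rintro ⟨T, B, S⟩ h
    simp only [mem_coe, mem_sigma, mem_powersetCard, subset_univ, true_and] at h
    obtain ⟨-, ⟨hBT, -⟩, hSB, -⟩ := h
    have hunion : T \ B ∪ S ∪ B = T := by
      rw [union_assoc, union_eq_right.2 hSB, sdiff_union_of_subset hBT]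
    have hinter : (T \ B ∪ S) ∩ B = S := by
      rw [union_inter_distrib_right, sdiff_inter_self, empty_union, inter_eq_left.2 hSB]
    simp only [hunion, hinter]

/-- The Hamming distance of two patterns in terms of their supports. -/
theorem hammingDist_add_wt_add_wt {α : Type*} [Fintype α] [DecidableEq α] (i j : α → Bool) :
    hammingDist i j + wt i + wt j
      = 2 * (univ.filter (fun a => i a = true) ∪ univ.filter (fun a => j a = true)).card := by
  simp only [hammingDist, wt, ← filter_or, card_filter, ← sum_add_distrib, mul_sum]
  refine sum_congr rfl fun a _ => ?_
  cases i a <;> cases j a <;> rfl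

/-- The number of ordered pairs `(i, i')` of binary patterns of length `m` with
`wt i = u`, `wt i' = v` and Hamming distance `2t - (u+v)` equals
`C(m,t) C(t,v) C(v, (u+v)-t)`. -/
theorem stmt2 (m u v t : ℕ) (huv : u ≤ v) (hvm : v ≤ m)
    (ht1 : v ≤ t) (ht2 : t ≤ min (u + v) m) :
    ((Finset.univ : Finset ((Fin m → Bool) × (Fin m → Bool))).filter
        (fun q => wt q.1 = u ∧ wt q.2 = v ∧
          hammingDist q.1 q.2 = 2 * t - (u + v))).card
      = m.choose t * t.choose v * v.choose ((u + v) - t) := by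
  have key := card_filter_card_union_eq (α := Fin m) (ht2.trans (min_le_left _ _))
  rw [Fintype.card_fin] at key
  rw [← key]
  let supp : (Fin m → Bool) → Finset (Fin m) := fun i => univ.filter fun a => i a = true
  let ind : Finset (Fin m) → Fin m → Bool := fun A a => decide (a ∈ A)
  have hsupp : ∀ A, supp (ind A) = A := fun A => by ext a; simp [supp, ind]
  have hind : ∀ i, ind (supp i) = i := fun i => by ext a; simp [supp, ind]
  have hwt : ∀ i, wt i = (supp i).card := fun _ => rfl
  have hdist : ∀ i j, hammingDist i j + wt i + wt j = 2 * (supp i ∪ supp j).card :=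
    hammingDist_add_wt_add_wt
  refine card_nbij' (fun q => (supp q.1, supp q.2)) (fun p => (ind p.1, ind p.2)) ?_ ?_ ?_ ?_
  · rintro ⟨i, j⟩ h
    simp only [coe_filter, mem_univ, true_and, Set.mem_ofPred_eq] at h ⊢
    have := hdist i j
    rw [← hwt, ← hwt]
    omega
  · rintro ⟨A, B⟩ h
    simp only [coe_filter, mem_univ, true_and, Set.mem_ofPred_eq] at h ⊢
    have := hdist (ind A) (ind B)
    rw [hwt, hwt, hsupp, hsupp] at this ⊢
    omega
  · rintro ⟨i, j⟩ -
    simp only [hind]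
  · rintro ⟨A, B⟩ -
    simp only [hsupp]
end

section
/- Let m = 2l be even, and let G be a perfect matching on {1,…,m} (a 1-regular simple graph), let M be a natural number, and let F01, F11 be positive reals. For distinct vertices p ≠ p′, let W(p,p′) be the product of w(e) over all edges e of G, computed from the single-target patterns i^(p) and i^(p′). Then the sum over all ordered pairs of distinct vertices (p,p′) of W(p,p′)^M equals m·F11^M + (m(m−1) − m)·F01^(2M). -/
open Finset

/-- Restricted weight of a pattern on a pair of positions: `i_a + i_b ∈ {0,1,2}`. -/
def rwt {α : Type*} (i : α → Bool) (a b : α) : ℕ :=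
  (i a).toNat + (i b).toNat

/-- The two-mode sub-fidelity weight of a pair of distinct positions `{a,b}`:
`1` if the restrictions of `i` and `i'` coincide; `F01` if the unordered pair of
restricted weights is `{0,1}`; `F11` if both restricted weights are `1` but the
restrictions differ; `F02` for restricted weights `{0,2}`; `F12` for `{1,2}`. -/
noncomputable def w {α : Type*} (F01 F11 F02 F12 : ℝ) (i i' : α → Bool) (a b : α) : ℝ :=
  if (i a, i b) = (i' a, i' b) then 1
  else if rwt i a b + rwt i' a b = 1 then F01
  else if rwt i a b + rwt i' a b = 3 then F12
  else if rwt i a b = 1 then F11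
  else F02

/-- The single-target CPF pattern with its unique `1` at position `p`. -/
def single {m : ℕ} (p : Fin m) : Fin m → Bool := fun a => decide (a = p)

open scoped Classical in
/-- Product of `w` over all edges of a graph `G` (each unordered edge `{a,b}`
encoded as the ordered pair with `a < b`). -/
noncomputable def Wgraph {m : ℕ} (G : SimpleGraph (Fin m)) (F01 F11 F02 F12 : ℝ)
    (i i' : Fin m → Bool) : ℝ :=
  ∏ p ∈ Finset.univ.filter (fun p : Fin m × Fin m => p.1 < p.2 ∧ G.Adj p.1 p.2),
    w F01 F11 F02 F12 i i' p.1 p.2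


/-- The sub-fidelity weight of two single-target patterns is trivial on a pair of positions
containing neither target. -/
lemma w_single_eq_one {m : ℕ} (F01 F11 F02 F12 : ℝ) {p p' a b : Fin m}
    (hpa : a ≠ p) (hpb : b ≠ p) (hpa' : a ≠ p') (hpb' : b ≠ p') :
    w F01 F11 F02 F12 (single p) (single p') a b = 1 := by
  simp [w, single, hpa, hpb, hpa', hpb']

/-- The sub-fidelity weight on a pair of positions consisting of the two targets. -/
lemma w_single_eq_F11 {m : ℕ} (F01 F11 F02 F12 : ℝ) {p p' a b : Fin m} (hab : a ≠ b)
    (h : a = p ∧ b = p' ∨ a = p' ∧ b = p) :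
    w F01 F11 F02 F12 (single p) (single p') a b = F11 := by
  rcases h with ⟨rfl, rfl⟩ | ⟨rfl, rfl⟩ <;> simp [w, rwt, single, hab, hab.symm]

/-- The sub-fidelity weight on a pair of positions containing the first target only. -/
lemma w_single_eq_F01_left {m : ℕ} (F01 F11 F02 F12 : ℝ) {p p' a b : Fin m} (hab : a ≠ b)
    (h : a = p ∨ b = p) (ha : a ≠ p') (hb : b ≠ p') :
    w F01 F11 F02 F12 (single p) (single p') a b = F01 := by
  rcases h with rfl | rfl <;> simp [w, rwt, single, hab, hab.symm, ha, hb]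

/-- The sub-fidelity weight on a pair of positions containing the second target only. -/
lemma w_single_eq_F01_right {m : ℕ} (F01 F11 F02 F12 : ℝ) {p p' a b : Fin m} (hab : a ≠ b)
    (h : a = p' ∨ b = p') (ha : a ≠ p) (hb : b ≠ p) :
    w F01 F11 F02 F12 (single p) (single p') a b = F01 := by
  rcases h with rfl | rfl <;> simp [w, rwt, single, hab, hab.symm, ha, hb]

/-- A regular graph of degree one is the graph of a partner function. -/
lemma exists_partner {V : Type*} (G : SimpleGraph V) [G.LocallyFinite]
    (hreg : G.IsRegularOfDegree 1) : ∃ f : V → V, ∀ a b, G.Adj a b ↔ b = f a := by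
  have h : ∀ a, ∃! b, G.Adj a b := fun a =>
    SimpleGraph.degree_eq_one_iff_existsUnique_adj.mp (hreg a)
  choose f hf hu using h
  exact ⟨f, fun a b => ⟨fun hab => hu a b hab, fun hab => hab ▸ hf a⟩⟩

/-- The total weight of two distinct single-target patterns over a perfect matching. -/
lemma Wgraph_single {m : ℕ} {G : SimpleGraph (Fin m)} {f : Fin m → Fin m}
    (hf : ∀ a b, G.Adj a b ↔ b = f a) (F01 F11 F02 F12 : ℝ) {p p' : Fin m} (hp : p ≠ p') :
    Wgraph G F01 F11 F02 F12 (single p) (single p') =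
      if p' = f p then F11 else F01 ^ 2 := by
  classical
  have hne : ∀ a, a ≠ f a := fun a => ((hf a (f a)).mpr rfl).ne
  have hinv : ∀ a, f (f a) = a := fun a => ((hf _ _).mp ((hf a (f a)).mpr rfl).symm).symm
  let e : Fin m → Fin m × Fin m := fun a => (min a (f a), max a (f a))
  have he : ∀ a, (e a = (a, f a) ∧ a < f a) ∨ (e a = (f a, a) ∧ f a < a) := by
    intro a
    rcases lt_or_gt_of_ne (hne a) with h | h
    · exact Or.inl ⟨by simp [e, h.le], h⟩
    · exact Or.inr ⟨by simp [e, h.le], h⟩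
  have hmem : ∀ a, (e a).1 < (e a).2 ∧ G.Adj (e a).1 (e a).2 := by
    intro a
    rcases he a with ⟨h, h'⟩ | ⟨h, h'⟩ <;> simp [h, h', hf, hinv]
  have hedge : ∀ x : Fin m × Fin m, x.1 < x.2 → G.Adj x.1 x.2 → ∀ a,
      (x.1 = a ∨ x.2 = a) → x = e a := by
    rintro ⟨x, y⟩ hlt hadj a h
    rw [hf] at hadj
    dsimp only at hadj hlt h
    subst hadj
    rcases h with rfl | rfl
    · simp [e, hlt.le]
    · simp [e, hlt.le, hinv]
  have hsub : Wgraph G F01 F11 F02 F12 (single p) (single p') =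
      ∏ x ∈ {e p, e p'}, w F01 F11 F02 F12 (single p) (single p') x.1 x.2 := by
    unfold Wgraph
    symm
    apply Finset.prod_subset
    · intro x hx
      simp only [Finset.mem_insert, Finset.mem_singleton] at hx
      rcases hx with rfl | rfl <;> simpa using hmem _
    · intro x hx hx'
      simp only [Finset.mem_filter, Finset.mem_univ, true_and] at hx
      simp only [Finset.mem_insert, Finset.mem_singleton, not_or] at hx'
      have h := hedge x hx.1 hx.2
      exact w_single_eq_one _ _ _ _ (fun h1 => hx'.1 (h p (Or.inl h1)))
        (fun h1 => hx'.1 (h p (Or.inr h1))) (fun h1 => hx'.2 (h p' (Or.inl h1)))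
        (fun h1 => hx'.2 (h p' (Or.inr h1)))
  rw [hsub]
  split_ifs with h
  · subst h
    have hee : e (f p) = e p := by simp [e, hinv, min_comm, max_comm]
    rw [hee, Finset.pair_eq_singleton, Finset.prod_singleton]
    refine w_single_eq_F11 _ _ _ _ (hmem p).1.ne ?_
    rcases he p with ⟨h, -⟩ | ⟨h, -⟩ <;> simp [h]
  · have h2 : p ≠ f p' := fun h' => h (by rw [h', hinv])
    have hee : e p ≠ e p' := by
      intro hcon
      rcases he p with ⟨h1, -⟩ | ⟨h1, -⟩ <;> rcases he p' with ⟨h3, -⟩ | ⟨h3, -⟩ <;>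
        rw [h1, h3, Prod.mk.injEq] at hcon <;> grind
    rw [Finset.prod_pair hee, sq]
    congr 1
    · apply w_single_eq_F01_left _ _ _ _ (hmem p).1.ne <;>
        rcases he p with ⟨h1, -⟩ | ⟨h1, -⟩ <;> simp [h1, hp, Ne.symm h]
    · apply w_single_eq_F01_right _ _ _ _ (hmem p').1.ne <;>
        rcases he p' with ⟨h1, -⟩ | ⟨h1, -⟩ <;> simp [h1, hp.symm, h2.symm]

/-- For even `m = 2l` and a perfect matching `G` (a 1-regular simple graph) on the
`m` channels, the total error quantity of the `M`-copy fixed (disjoint) block CPF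
protocol equals `m F11^M + (m(m-1) - m) F01^(2M)`. -/
theorem stmt8 {m l : ℕ} (hm : m = 2 * l)
    (G : SimpleGraph (Fin m)) [DecidableRel G.Adj] (hreg : G.IsRegularOfDegree 1)
    (M : ℕ) (F01 F11 F02 F12 : ℝ)
    (hF01 : 0 < F01) (hF11 : 0 < F11) (hF02 : 0 < F02) (hF12 : 0 < F12) :
    ∑ q ∈ (Finset.univ : Finset (Fin m)).offDiag,
        (Wgraph G F01 F11 F02 F12 (single q.1) (single q.2)) ^ M
      = (m : ℝ) * F11 ^ M
        + ((m : ℝ) * ((m : ℝ) - 1) - (m : ℝ)) * F01 ^ (2 * M) := by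
  obtain ⟨f, hf⟩ := exists_partner G hreg
  have hne : ∀ a, a ≠ f a := fun a => ((hf a (f a)).mpr rfl).ne
  have hterm : ∀ q ∈ (Finset.univ : Finset (Fin m)).offDiag,
      (Wgraph G F01 F11 F02 F12 (single q.1) (single q.2)) ^ M =
        F01 ^ (2 * M) + if q.2 = f q.1 then F11 ^ M - F01 ^ (2 * M) else 0 := by
    intro q hq
    rw [Wgraph_single hf _ _ _ _ (Finset.mem_offDiag.mp hq).2.2]
    split_ifs
    · ring
    · rw [pow_mul, add_zero]
  have hcard : ((Finset.univ : Finset (Fin m)).offDiag.filter (fun q => q.2 = f q.1)).card = m := by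
    have himage : (Finset.univ : Finset (Fin m)).offDiag.filter (fun q => q.2 = f q.1) =
        Finset.univ.image (fun a => (a, f a)) := by
      ext ⟨a, b⟩
      simp only [Finset.mem_filter, Finset.mem_offDiag, Finset.mem_univ, true_and,
        Finset.mem_image, Prod.mk.injEq]
      constructor
      · rintro ⟨-, rfl⟩
        exact ⟨a, rfl, rfl⟩
      · rintro ⟨c, rfl, rfl⟩
        exact ⟨hne c, rfl⟩
    rw [himage, Finset.card_image_of_injective _ (fun a b h => (Prod.mk.inj h).1),
      Finset.card_univ, Fintype.card_fin]
  rw [Finset.sum_congr rfl hterm, Finset.sum_add_distrib, ← Finset.sum_filter,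
    Finset.sum_const, Finset.sum_const, hcard, Finset.offDiag_card, Finset.card_univ,
    Fintype.card_fin, nsmul_eq_mul, nsmul_eq_mul, Nat.cast_sub (Nat.le_mul_self m)]
  push_cast
  ring
end

section
/- Let m ≥ 2 and 1 ≤ u ≤ m, let M be a natural number, and let F01, F11, F02, F12 be positive reals. For binary patterns i, i′ of length m, let W(i,i′) be the product of w(e) over all unordered pairs e of distinct positions in {1,…,m}. Then the sum, over all ordered pairs (i,i′) of distinct binary patterns each of weight exactly u, of W(i,i′)^M equals the sum over t = u+1,…,2u of C(m,t)·C(t,u)·C(u, 2u−t) · ( F01^(d(2(m−u)−d)/2) · F11^(d²/4) · F02^(d(d−2)/4) · F12^(d(2u−d)/2) )^M, where d = 2(t−u) and C(·,·) is the binomial coefficient. -/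
open Finset
open scoped Classical

/-- Product of `w` over all unordered pairs `{a,b}` of distinct positions
(the `k_max = m-1` local-nearest-neighbour probe-domain distribution). -/
noncomputable def Wfull {m : ℕ} (F01 F11 F02 F12 : ℝ) (i i' : Fin m → Bool) : ℝ :=
  ∏ p ∈ Finset.univ.filter (fun p : Fin m × Fin m => p.1 < p.2),
    w F01 F11 F02 F12 i i' p.1 p.2

section PatternPairs

/-- The weight of a pair of positions depends only on the values of both patterns there. -/
lemma w_eq_of_values {α : Type*} (F01 F11 F02 F12 : ℝ) (i i' : α → Bool) (a b : α) :
    w F01 F11 F02 F12 i i' a b =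
      w F01 F11 F02 F12 (Prod.fst : Bool × Bool → Bool) Prod.snd (i a, i' a) (i b, i' b) := rfl

lemma w_comm {α : Type*} (F01 F11 F02 F12 : ℝ) (i i' : α → Bool) (a b : α) :
    w F01 F11 F02 F12 i i' a b = w F01 F11 F02 F12 i i' b a := by
  unfold w rwt
  cases i a <;> cases i b <;> cases i' a <;> cases i' b <;> simp

lemma w_pos {α : Type*} {F01 F11 F02 F12 : ℝ} (hF01 : 0 < F01) (hF11 : 0 < F11)
    (hF02 : 0 < F02) (hF12 : 0 < F12) (i i' : α → Bool) (a b : α) :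
    0 < w F01 F11 F02 F12 i i' a b := by
  unfold w
  split_ifs <;> simp [*]

/-- The number of positions where the pair of patterns takes the value `x`. -/
def pairCount {α : Type*} [Fintype α] (i i' : α → Bool) (x : Bool × Bool) : ℕ :=
  (Finset.univ.filter fun a => (i a, i' a) = x).card

lemma prod_comp_pair {α : Type*} [Fintype α] (i i' : α → Bool) (f : Bool × Bool → ℝ) :
    ∏ a, f (i a, i' a) = ∏ x, f x ^ pairCount i i' x := by
  rw [← Finset.prod_fiberwise (s := Finset.univ) (g := fun a => (i a, i' a))]
  refine Finset.prod_congr rfl fun x _ => ?_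
  rw [pairCount, ← Finset.prod_const]
  refine Finset.prod_congr (by ext; simp) fun a ha => ?_
  rw [(Finset.mem_filter.1 ha).2]

lemma prod_prod_comp_pair {α : Type*} [Fintype α] (i i' : α → Bool)
    (f : Bool × Bool → Bool × Bool → ℝ) :
    ∏ a, ∏ b, f (i a, i' a) (i b, i' b) =
      ∏ x, (∏ y, f x y ^ pairCount i i' y) ^ pairCount i i' x := by
  rw [← prod_comp_pair]
  exact Finset.prod_congr rfl fun a _ => prod_comp_pair i i' _

lemma prod_prod_eq_sq_mul_diag {m : ℕ} (g : Fin m → Fin m → ℝ) (hg : ∀ a b, g a b = g b a) :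
    ∏ a, ∏ b, g a b =
      (∏ p ∈ Finset.univ.filter (fun p : Fin m × Fin m => p.1 < p.2), g p.1 p.2) ^ 2 *
        ∏ a, g a a := by
  have hswap : ∏ p ∈ Finset.univ.filter (fun p : Fin m × Fin m => p.2 < p.1), g p.1 p.2 =
      ∏ p ∈ Finset.univ.filter (fun p : Fin m × Fin m => p.1 < p.2), g p.1 p.2 :=
    Finset.prod_nbij' Prod.swap Prod.swap (by simp) (by simp) (by simp) (by simp)
      (fun p _ => hg _ _)
  have hdiag : ∏ p ∈ Finset.univ.filter (fun p : Fin m × Fin m => p.1 = p.2), g p.1 p.2 =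
      ∏ a, g a a :=
    Finset.prod_nbij' Prod.fst (fun a => (a, a)) (by simp) (by simp)
      (by rintro ⟨a, b⟩ h; simpa using h) (by simp)
      (by rintro ⟨a, b⟩ h; simp at h; simp [h])
  rw [← hdiag, sq]
  nth_rewrite 2 [← hswap]
  rw [← Fintype.prod_prod_type', ← Finset.prod_filter_mul_prod_filter_not Finset.univ
    (fun p : Fin m × Fin m => p.1 < p.2), mul_assoc]
  congr 1
  rw [← Finset.prod_filter_mul_prod_filter_not
    (Finset.univ.filter fun p : Fin m × Fin m => ¬ p.1 < p.2) (fun p => p.2 < p.1)]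
  congr 1 <;> refine Finset.prod_congr ?_ fun _ _ => rfl <;> ext p <;>
    simp only [Finset.mem_filter, Finset.mem_univ, true_and] <;> omega

lemma Wfull_pos {m : ℕ} {F01 F11 F02 F12 : ℝ} (hF01 : 0 < F01) (hF11 : 0 < F11)
    (hF02 : 0 < F02) (hF12 : 0 < F12) (i i' : Fin m → Bool) :
    0 < Wfull F01 F11 F02 F12 i i' :=
  Finset.prod_pos fun _ _ => w_pos hF01 hF11 hF02 hF12 _ _ _ _

lemma Wfull_eq {m : ℕ} {F01 F11 F02 F12 : ℝ} (hF01 : 0 < F01) (hF11 : 0 < F11)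
    (hF02 : 0 < F02) (hF12 : 0 < F12) (i i' : Fin m → Bool) {n c s : ℕ}
    (hn : pairCount i i' (false, false) = n) (hc : pairCount i i' (true, true) = c)
    (hs : pairCount i i' (false, true) = s) (hs' : pairCount i i' (true, false) = s) :
    Wfull F01 F11 F02 F12 i i' =
      F01 ^ (2 * s * n) * F11 ^ (s ^ 2) * F02 ^ (s * (s - 1)) * F12 ^ (2 * s * c) := by
  have h : ∏ a, ∏ b, w F01 F11 F02 F12 i i' a b =
      Wfull F01 F11 F02 F12 i i' ^ 2 * ∏ a, w F01 F11 F02 F12 i i' a a :=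
    prod_prod_eq_sq_mul_diag _ fun a b => w_comm _ _ _ _ _ _ _ _
  have hprod := prod_prod_comp_pair i i' (w F01 F11 F02 F12 Prod.fst Prod.snd)
  have hdiag := prod_comp_pair i i' (fun x => w F01 F11 F02 F12 Prod.fst Prod.snd x x)
  simp only [← w_eq_of_values] at hprod hdiag
  rw [hprod, hdiag] at h
  simp only [Fintype.prod_prod_type, Fintype.prod_bool, hn, hc, hs, hs'] at h
  simp [w, rwt] at h
  refine (pow_left_inj₀ (Wfull_pos hF01 hF11 hF02 hF12 i i').le (by positivity)
    two_ne_zero).1 ?_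
  refine mul_right_cancel₀ (b := F02 ^ s * F02 ^ s) (by positivity) ?_
  rw [← h]
  have hF02s : F02 ^ (s * (s - 1)) * F02 ^ s = F02 ^ (s * s) := by
    rw [← pow_add]
    cases s <;> simp [Nat.mul_succ]
  calc
    _ = (F01 ^ (2 * s * n) * F11 ^ (s ^ 2) * F12 ^ (2 * s * c)) ^ 2 * (F02 ^ (s * s)) ^ 2 := by
      ring
    _ = _ := by
      rw [← hF02s]
      ring

lemma pairCount_add_left {α : Type*} [Fintype α] (i i' : α → Bool) :
    pairCount i i' (true, true) + pairCount i i' (true, false) = wt i := by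
  simp only [pairCount, wt, Finset.card_filter, ← Finset.sum_add_distrib]
  refine Finset.sum_congr rfl fun a _ => ?_
  cases i a <;> cases i' a <;> simp

lemma pairCount_add_right {α : Type*} [Fintype α] (i i' : α → Bool) :
    pairCount i i' (true, true) + pairCount i i' (false, true) = wt i' := by
  simp only [pairCount, wt, Finset.card_filter, ← Finset.sum_add_distrib]
  refine Finset.sum_congr rfl fun a _ => ?_
  cases i a <;> cases i' a <;> simp

lemma pairCount_add_all {α : Type*} [Fintype α] (i i' : α → Bool) :
    pairCount i i' (false, false) + pairCount i i' (true, false) + wt i' = Fintype.card α := by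
  rw [Fintype.card_eq_sum_ones]
  simp only [pairCount, wt, Finset.card_filter, ← Finset.sum_add_distrib]
  refine Finset.sum_congr rfl fun a _ => ?_
  cases i a <;> cases i' a <;> simp

lemma card_filter_wt_eq {α : Type*} [Fintype α] (u : ℕ) :
    (Finset.univ.filter fun i : α → Bool => wt i = u).card = (Fintype.card α).choose u := by
  rw [← Finset.card_univ, ← Finset.card_powersetCard]
  refine Finset.card_nbij' (fun i => Finset.univ.filter fun a => i a = true)
    (fun A a => decide (a ∈ A)) ?_ ?_ ?_ ?_
  · intro i hi
    have hi := (Finset.mem_filter.1 (Finset.mem_coe.1 hi)).2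
    simpa [wt, Finset.mem_powersetCard] using hi
  · intro A hA
    refine Finset.mem_coe.2 (Finset.mem_filter.2 ⟨Finset.mem_univ _, ?_⟩)
    simpa [wt, Finset.mem_powersetCard] using hA
  · intro i _
    ext a
    simp
  · intro A _
    ext a
    simp

lemma card_filter_pairCount_eq {α : Type*} [Fintype α] (i : α → Bool) (c s : ℕ) :
    (Finset.univ.filter fun i' : α → Bool =>
      pairCount i i' (true, true) = c ∧ pairCount i i' (false, true) = s).card =
      (wt i).choose c * (Fintype.card α - wt i).choose s := by
  have hcompl : (Finset.univ.filter fun a => i a = true)ᶜ.card = Fintype.card α - wt i :=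
    Finset.card_compl _
  rw [← hcompl, wt, ← Finset.card_powersetCard, ← Finset.card_powersetCard,
    ← Finset.card_product]
  refine Finset.card_nbij' (fun i' => (Finset.univ.filter fun a => (i a, i' a) = (true, true),
    Finset.univ.filter fun a => (i a, i' a) = (false, true)))
    (fun A a => decide (a ∈ A.1 ∪ A.2)) ?_ ?_ ?_ ?_
  · intro i' hi'
    have hi' := (Finset.mem_filter.1 (Finset.mem_coe.1 hi')).2
    simp only [pairCount] at hi'
    simp only [Finset.coe_product, Set.mem_prod, Finset.mem_coe, Finset.mem_powersetCard]
    refine ⟨⟨fun a => ?_, hi'.1⟩, fun a => ?_, hi'.2⟩ <;> simp +contextual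
  · rintro ⟨A, B⟩ h
    simp only [Finset.coe_product, Set.mem_prod, Finset.mem_coe, Finset.mem_powersetCard,
      Finset.subset_iff, Finset.mem_compl, Finset.mem_filter, Finset.mem_univ, true_and] at h
    obtain ⟨⟨hA, rfl⟩, hB, rfl⟩ := h
    refine Finset.mem_coe.2 (Finset.mem_filter.2 ⟨Finset.mem_univ _, ?_⟩)
    simp only [pairCount]
    constructor <;> congr 1 <;> ext a <;> have := @hA a <;> have := @hB a <;> simp <;> grind
  · intro i' _
    ext a
    cases h : i a <;> simp [h]
  · rintro ⟨A, B⟩ h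
    simp only [Finset.coe_product, Set.mem_prod, Finset.mem_coe, Finset.mem_powersetCard,
      Finset.subset_iff, Finset.mem_compl, Finset.mem_filter, Finset.mem_univ, true_and] at h
    obtain ⟨⟨hA, -⟩, hB, -⟩ := h
    refine Prod.ext ?_ ?_ <;> ext a <;> have := @hA a <;> have := @hB a <;> simp <;> grind

/-- Ordered pairs of patterns of weight `u` whose supports have a union of size `u + s`. -/
lemma card_filter_pairs {α : Type*} [Fintype α] {u s : ℕ} (hs : s ≤ u) :
    (Finset.univ.filter fun q : (α → Bool) × (α → Bool) =>
      (wt q.1 = u ∧ wt q.2 = u) ∧ pairCount q.1 q.2 (false, true) = s).card =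
      (Fintype.card α).choose (u + s) * (u + s).choose u * u.choose (u - s) := by
  have hfib : ∀ i ∈ Finset.univ.filter (fun i : α → Bool => wt i = u),
      (Finset.univ.filter fun i' : α → Bool =>
        wt i' = u ∧ pairCount i i' (false, true) = s).card =
      u.choose (u - s) * (Fintype.card α - u).choose s := by
    intro i hi
    have hi : wt i = u := by simpa using hi
    have h := card_filter_pairCount_eq i (u - s) s
    rw [hi] at h
    rw [← h]
    congr 1
    ext i'
    have := pairCount_add_right i i'
    simp only [Finset.mem_filter, Finset.mem_univ, true_and]
    omega
  have hcard : (Finset.univ.filter fun q : (α → Bool) × (α → Bool) =>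
      (wt q.1 = u ∧ wt q.2 = u) ∧ pairCount q.1 q.2 (false, true) = s).card =
      ∑ i ∈ Finset.univ.filter (fun i : α → Bool => wt i = u),
        (Finset.univ.filter fun i' : α → Bool =>
          wt i' = u ∧ pairCount i i' (false, true) = s).card := by
    simp only [Finset.card_filter, Finset.sum_filter, Fintype.sum_prod_type]
    refine Finset.sum_congr rfl fun i _ => ?_
    by_cases h : wt i = u <;> simp [h]
  rw [hcard, Finset.sum_congr rfl hfib, Finset.sum_const, card_filter_wt_eq, smul_eq_mul]
  by_cases hle : u + s ≤ Fintype.card α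
  · rw [Nat.choose_mul (Nat.le_add_right u s), Nat.add_sub_cancel_left]
    ring
  · rw [Nat.choose_eq_zero_of_lt (not_le.1 hle)]
    rcases lt_or_ge (Fintype.card α) u with h | h
    · simp [Nat.choose_eq_zero_of_lt h]
    · rw [Nat.choose_eq_zero_of_lt (n := Fintype.card α - u) (by omega)]
      simp

/-- Patterns of equal weight differ iff some position belongs only to the second one. -/
lemma ne_iff_pairCount_ne_zero {α : Type*} [Fintype α] {i i' : α → Bool} (h : wt i = wt i') :
    i ≠ i' ↔ pairCount i i' (false, true) ≠ 0 := by
  have h1 := pairCount_add_left i i'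
  have h2 := pairCount_add_right i i'
  rw [not_iff_not]
  constructor
  · rintro rfl
    simp [pairCount]
  · intro h0
    have h0' : pairCount i i' (true, false) = 0 := by omega
    simp only [pairCount, Finset.card_eq_zero, Finset.filter_eq_empty_iff, Finset.mem_univ,
      true_implies, Prod.mk.injEq] at h0 h0'
    ext a
    have := @h0 a
    have := @h0' a
    grind

end PatternPairs

/-- Total error quantity of the `M`-copy `k_max`-LNN protocol over the `u`-CPF
image space, re-parameterised as a sum over `t = u+1,…,2u` with `d = 2(t-u)`. -/
theorem stmt11 (m u : ℕ) (hm : 2 ≤ m) (hu1 : 1 ≤ u) (hum : u ≤ m) (M : ℕ)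
    (F01 F11 F02 F12 : ℝ)
    (hF01 : 0 < F01) (hF11 : 0 < F11) (hF02 : 0 < F02) (hF12 : 0 < F12) :
    ∑ q ∈ (Finset.univ : Finset (Fin m → Bool)).offDiag.filter
        (fun q => wt q.1 = u ∧ wt q.2 = u),
        (Wfull F01 F11 F02 F12 q.1 q.2) ^ M
      = ∑ t ∈ Finset.Icc (u + 1) (2 * u),
          (m.choose t * t.choose u * u.choose (2 * u - t) : ℝ) *
            (F01 ^ (2 * (t - u) * (2 * (m - u) - 2 * (t - u)) / 2) *
              F11 ^ ((2 * (t - u)) ^ 2 / 4) *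
              F02 ^ (2 * (t - u) * (2 * (t - u) - 2) / 4) *
              F12 ^ (2 * (t - u) * (2 * u - 2 * (t - u)) / 2)) ^ M := by
  have hmaps : ∀ q ∈ (Finset.univ : Finset (Fin m → Bool)).offDiag.filter
      (fun q => wt q.1 = u ∧ wt q.2 = u),
      u + pairCount q.1 q.2 (false, true) ∈ Finset.Icc (u + 1) (2 * u) := by
    rintro ⟨i, i'⟩ hq
    simp only [Finset.mem_filter, Finset.mem_offDiag, Finset.mem_univ, true_and] at hq
    obtain ⟨hne, h1, h2⟩ := hq
    have := (ne_iff_pairCount_ne_zero (h1.trans h2.symm)).1 hne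
    have := pairCount_add_right i i'
    simp only [Finset.mem_Icc]
    omega
  rw [← Finset.sum_fiberwise_of_maps_to hmaps]
  refine Finset.sum_congr rfl fun t ht => ?_
  obtain ⟨ht1, ht2⟩ := Finset.mem_Icc.1 ht
  obtain ⟨s, rfl⟩ : ∃ s, t = u + s := ⟨t - u, by omega⟩
  have hfilter : ((Finset.univ : Finset (Fin m → Bool)).offDiag.filter
      (fun q => wt q.1 = u ∧ wt q.2 = u)).filter
        (fun q => u + pairCount q.1 q.2 (false, true) = u + s) =
      Finset.univ.filter fun q : (Fin m → Bool) × (Fin m → Bool) =>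
        (wt q.1 = u ∧ wt q.2 = u) ∧ pairCount q.1 q.2 (false, true) = s := by
    ext ⟨i, i'⟩
    simp only [Finset.mem_filter, Finset.mem_offDiag, Finset.mem_univ, true_and]
    constructor
    · rintro ⟨⟨-, h⟩, hs⟩
      exact ⟨h, by omega⟩
    · rintro ⟨h, hs⟩
      refine ⟨⟨(ne_iff_pairCount_ne_zero (h.1.trans h.2.symm)).2 (by omega), h⟩, by omega⟩
  have hcard := card_filter_pairs (α := Fin m) (u := u) (s := s) (by omega)
  rw [Fintype.card_fin] at hcard
  rw [hfilter]
  have hval : ∀ q ∈ Finset.univ.filter (fun q : (Fin m → Bool) × (Fin m → Bool) =>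
      (wt q.1 = u ∧ wt q.2 = u) ∧ pairCount q.1 q.2 (false, true) = s),
      Wfull F01 F11 F02 F12 q.1 q.2 ^ M =
        (F01 ^ (2 * s * (m - u - s)) * F11 ^ (s ^ 2) * F02 ^ (s * (s - 1)) *
          F12 ^ (2 * s * (u - s))) ^ M := by
    rintro ⟨i, i'⟩ hq
    simp only [Finset.mem_filter, Finset.mem_univ, true_and] at hq
    obtain ⟨⟨h1, h2⟩, hs⟩ := hq
    have hl := pairCount_add_left i i'
    have hr := pairCount_add_right i i'
    have ha := pairCount_add_all i i'
    rw [Fintype.card_fin] at ha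
    rw [Wfull_eq hF01 hF11 hF02 hF12 i i' (n := m - u - s) (c := u - s) (s := s)
      (by omega) (by omega) hs (by omega)]
  rw [Finset.sum_congr rfl hval, Finset.sum_const, nsmul_eq_mul,
    Nat.add_sub_cancel_left, show 2 * u - (u + s) = u - s by omega]
  have e1 : 2 * s * (2 * (m - u) - 2 * s) / 2 = 2 * s * (m - u - s) := by
    rw [← Nat.mul_sub, mul_left_comm, Nat.mul_div_cancel_left _ two_pos]
  have e2 : (2 * s) ^ 2 / 4 = s ^ 2 := by
    rw [mul_pow]
    exact Nat.mul_div_cancel_left _ (by norm_num)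
  have e3 : 2 * s * (2 * s - 2) / 4 = s * (s - 1) := by
    rw [show 2 * s - 2 = 2 * (s - 1) by omega, mul_mul_mul_comm]
    exact Nat.mul_div_cancel_left _ (by norm_num)
  have e4 : 2 * s * (2 * u - 2 * s) / 2 = 2 * s * (u - s) := by
    rw [← Nat.mul_sub, mul_left_comm, Nat.mul_div_cancel_left _ two_pos]
  rw [e1, e2, e3, e4]
  congr 1
  rw [← Nat.cast_mul, ← Nat.cast_mul, ← hcard]
  congr 2
  ext q
  simp only [Finset.mem_filter, Finset.mem_univ]
end
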